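/- arXiv:2401.02116 — 3 statements merged into one kernel-verified Lean document; each statement's English description precedes it below -/
import Mathlib

section
/- Let G be the disjoint union of cliques C_1, …, C_t of sizes α_1, …, α_t, with vertex set V of size |V| = Σ_i α_i, and let the vertex set be partitioned into blocks each of size Ω ≥ 2. Then OR(G) = (Σ_{i=1}^{t} α_i(α_i − 1)) / (|V|·(Ω − 1)) if and only if every clique C_i is entirely contained in a single block. -/
open Finset

variable {V : Type*}

/-- The overlap ratio `OR(u)` of a vertex `u` for the block layout `blk`. -/
noncomputable def ORv [Fintype V] [DecidableEq V] (G : SimpleGraph V) [DecidableRel G.Adj]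
    (blk : V → Finset V) (u : V) : ℝ :=
  if 1 < (blk u).card then
    ((blk u ∩ G.neighborFinset u).card : ℝ) / (((blk u).card : ℝ) - 1)
  else 0

/-- The overlap ratio `OR(G) = (1/|V|) ∑_{u ∈ V} OR(u)` of the layout `blk`. -/
noncomputable def ORG [Fintype V] [DecidableEq V] (G : SimpleGraph V) [DecidableRel G.Adj]
    (blk : V → Finset V) : ℝ :=
  (∑ u : V, ORv G blk u) / (Fintype.card V : ℝ)

/-- The overlap ratio with blocks of size `Ω` attains the average degree over `Ω - 1` iff every
neighborhood is contained in the block of its vertex. -/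
theorem ORG_eq_sum_degree_iff [Fintype V] [DecidableEq V] (G : SimpleGraph V)
    [DecidableRel G.Adj] (blk : V → Finset V) {Ω : ℕ} (hΩ : 2 ≤ Ω)
    (hblk : ∀ u, (blk u).card = Ω) :
    ORG G blk = (∑ u, (G.degree u : ℝ)) / ((Fintype.card V : ℝ) * ((Ω : ℝ) - 1)) ↔
      ∀ u, G.neighborFinset u ⊆ blk u := by
  cases isEmpty_or_nonempty V
  · simp [ORG]
  have hV : (Fintype.card V : ℝ) ≠ 0 := by exact_mod_cast Fintype.card_ne_zero
  have hΩ' : (Ω : ℝ) - 1 ≠ 0 := by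
    have : (2 : ℝ) ≤ Ω := by exact_mod_cast hΩ
    linarith
  have hORG : ORG G blk = (∑ u, ((blk u ∩ G.neighborFinset u).card : ℝ)) /
      ((Fintype.card V : ℝ) * ((Ω : ℝ) - 1)) := by
    simp only [ORG, ORv, hblk, if_pos (show 1 < Ω by lia), ← Finset.sum_div]
    rw [div_div, mul_comm]
  rw [hORG, div_left_inj' (mul_ne_zero hV hΩ')]
  norm_cast
  simp only [← G.card_neighborFinset_eq_degree]
  rw [Finset.sum_eq_sum_iff_of_le fun u _ => Finset.card_le_card Finset.inter_subset_right]
  refine forall_congr' fun u => ?_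
  rw [← Finset.inter_eq_right]
  refine ⟨fun h => Finset.eq_of_subset_of_card_le Finset.inter_subset_right
    (h (Finset.mem_univ u)).ge, fun h _ => congrArg Finset.card h⟩

/-- In a disjoint union of cliques, the degree sum is the sum of `a (a - 1)` over the clique
sizes `a`. -/
theorem sum_degree_eq_sum_card_fiber [Fintype V] [DecidableEq V] {ι : Type*} [Fintype ι]
    [DecidableEq ι] (G : SimpleGraph V) [DecidableRel G.Adj] (c : V → ι)
    (hG : ∀ u v : V, G.Adj u v ↔ u ≠ v ∧ c u = c v) :
    ∑ u, (G.degree u : ℝ) = ∑ i, ((Finset.univ.filter fun v => c v = i).card : ℝ) *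
      (((Finset.univ.filter fun v => c v = i).card : ℝ) - 1) := by
  have hdeg (u : V) : (G.degree u : ℝ) =
      ((Finset.univ.filter fun v => c v = c u).card : ℝ) - 1 := by
    have hN : G.neighborFinset u = (Finset.univ.filter fun v => c v = c u).erase u := by
      ext v
      simp [hG, eq_comm]
    rw [← G.card_neighborFinset_eq_degree, hN, Finset.cast_card_erase_of_mem (by simp)]
  rw [← Finset.sum_fiberwise Finset.univ c]
  refine Finset.sum_congr rfl fun i _ => ?_
  rw [← nsmul_eq_mul]
  refine Finset.sum_eq_card_nsmul fun u hu => ?_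
  rw [hdeg, (Finset.mem_filter.mp hu).2]

/-- Let `G` be the disjoint union of cliques `C_1, …, C_t` of sizes
`α_1, …, α_t` (the cliques being the fibers of `c : V → Fin t`), and let the vertex set
be partitioned into blocks, each of size `Ω ≥ 2`.  Then
`OR(G) = (∑ i, α_i (α_i − 1)) / (|V| (Ω − 1))` iff every clique is entirely contained
in a single block (i.e. vertices in the same clique always lie in the same block). -/
theorem ORG_eq_iff_cliques_in_blocks
    [Fintype V] [DecidableEq V] (t : ℕ)
    (G : SimpleGraph V) [DecidableRel G.Adj] (c : V → Fin t)
    (hG : ∀ u v : V, G.Adj u v ↔ u ≠ v ∧ c u = c v)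
    (α : Fin t → ℕ) (hαpos : ∀ i, 1 ≤ α i)
    (hα : ∀ i, (Finset.univ.filter fun v => c v = i).card = α i)
    (blk : V → Finset V)
    (hself : ∀ v, v ∈ blk v)
    (hpart : ∀ u v : V, v ∈ blk u → blk v = blk u)
    (Ω : ℕ) (hΩ : 2 ≤ Ω) (hblk : ∀ u, (blk u).card = Ω) :
    ORG G blk =
        (∑ i, (α i : ℝ) * ((α i : ℝ) - 1)) / ((Fintype.card V : ℝ) * ((Ω : ℝ) - 1)) ↔
      ∀ u v : V, c u = c v → blk u = blk v := by
  have hsum := sum_degree_eq_sum_card_fiber G c hG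
  simp only [hα] at hsum
  rw [← hsum, ORG_eq_sum_degree_iff G blk hΩ hblk]
  refine ⟨fun h u v huv => ?_, fun h u v hv => ?_⟩
  · rcases eq_or_ne u v with rfl | hne
    · rfl
    · exact (hpart u v (h u ((G.mem_neighborFinset u v).2 ((hG u v).2 ⟨hne, huv⟩)))).symm
  · rw [h u v ((hG u v).1 ((G.mem_neighborFinset u v).1 hv)).2]
    exact hself v
end

section
/- Let ρ and Ω ≥ 2 be positive integers, t = 3ρ, and let α_1, …, α_t be positive integers with Ω/4 < α_i < Ω/2 for every i and Σ_i α_i = ρ·Ω. Let G be the disjoint union of cliques C_1, …, C_t of sizes α_1, …, α_t. If there exists a partition of the vertex set of G into ρ blocks each of size Ω with OR(G) = (Σ_i α_i(α_i − 1)) / (ρ·Ω·(Ω − 1)), then the index set {1, …, t} can be partitioned into ρ triples such that the α-sum of each triple equals Ω. -/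
open Finset

variable {V : Type*}

/-- In a disjoint union of cliques, given as the fibers of `c`, the neighbors of `u` are the other
vertices of its fiber. -/
theorem neighborFinset_eq_fiber_erase {ι : Type*} [Fintype V] [DecidableEq V] [DecidableEq ι]
    (G : SimpleGraph V) [DecidableRel G.Adj] (c : V → ι)
    (hG : ∀ u v : V, G.Adj u v ↔ u ≠ v ∧ c u = c v) (u : V) :
    G.neighborFinset u = (univ.filter fun v => c v = c u).erase u := by
  ext v
  simp only [SimpleGraph.mem_neighborFinset, hG, mem_erase, mem_filter, mem_univ, true_and]
  exact and_congr ne_comm eq_comm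

/-- A layout into blocks of size `Ω` whose total overlap is the total degree of `G` puts every
vertex in the same block as its neighbors. -/
theorem neighborFinset_subset_of_sum_ORv_eq [Fintype V] [DecidableEq V]
    (G : SimpleGraph V) [DecidableRel G.Adj] (blk : V → Finset V) {Ω : ℕ} (hΩ : 2 ≤ Ω)
    (hcard : ∀ u, (blk u).card = Ω)
    (h : ∑ u, ORv G blk u = (∑ u, (G.degree u : ℝ)) / ((Ω : ℝ) - 1)) (u : V) :
    G.neighborFinset u ⊆ blk u := by
  have hΩ' : (Ω : ℝ) - 1 ≠ 0 := by
    have : (2 : ℝ) ≤ Ω := by exact_mod_cast hΩ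
    linarith
  have hv : ∀ u, ORv G blk u = ((blk u ∩ G.neighborFinset u).card : ℝ) / ((Ω : ℝ) - 1) := by
    intro u
    rw [ORv, hcard, if_pos (by omega)]
  simp only [hv, ← Finset.sum_div] at h
  rw [div_left_inj' hΩ'] at h
  have hle : ∀ u ∈ (univ : Finset V), (blk u ∩ G.neighborFinset u).card ≤ G.degree u :=
    fun u _ => card_le_card inter_subset_right
  have heq := (sum_eq_sum_iff_of_le hle).1 (by exact_mod_cast h) u (mem_univ u)
  exact inter_eq_right.1 (eq_of_subset_of_card_le inter_subset_right heq.ge)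

/-- The sum of the degrees in a disjoint union of cliques of sizes `α i`. -/
theorem sum_degree_of_fiber_cliques {ι : Type*} [Fintype ι] [Fintype V] [DecidableEq V]
    [DecidableEq ι] (G : SimpleGraph V) [DecidableRel G.Adj] (c : V → ι) (α : ι → ℕ)
    (hG : ∀ u v : V, G.Adj u v ↔ u ≠ v ∧ c u = c v)
    (hα : ∀ i, (univ.filter fun v => c v = i).card = α i) :
    ∑ u, (G.degree u : ℝ) = ∑ i, (α i : ℝ) * ((α i : ℝ) - 1) := by
  have hdeg : ∀ u, (G.degree u : ℝ) = (α (c u) : ℝ) - 1 := by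
    intro u
    have hu : u ∈ univ.filter fun v => c v = c u := by simp
    have h := card_erase_add_one hu
    rw [← neighborFinset_eq_fiber_erase G c hG, hα, SimpleGraph.card_neighborFinset_eq_degree] at h
    rw [← h]
    push_cast
    ring
  rw [← Finset.sum_fiberwise univ c]
  refine sum_congr rfl fun i _ => ?_
  rw [← hα i, ← nsmul_eq_mul, ← sum_const]
  refine sum_congr rfl fun u hu => ?_
  rw [hdeg, (mem_filter.1 hu).2, hα]

/-- If every summand lies strictly between `Ω / 4` and `Ω / 2` and the sum is `Ω`, there are three
summands. -/
theorem card_eq_three_of_sum_eq {ι : Type*} {s : Finset ι} {α : ι → ℕ} {Ω : ℕ}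
    (hs : s.Nonempty) (hlb : ∀ i, Ω < 4 * α i) (hub : ∀ i, 2 * α i < Ω)
    (h : ∑ i ∈ s, α i = Ω) : s.card = 3 := by
  have h4 : ∑ _i ∈ s, Ω < ∑ i ∈ s, 4 * α i := sum_lt_sum_of_nonempty hs fun i _ => hlb i
  have h2 : ∑ i ∈ s, 2 * α i < ∑ _i ∈ s, Ω := sum_lt_sum_of_nonempty hs fun i _ => hub i
  rw [← mul_sum, h, sum_const, smul_eq_mul] at h4 h2
  have := lt_of_mul_lt_mul_right h4 (Nat.zero_le Ω)
  have := lt_of_mul_lt_mul_right h2 (Nat.zero_le Ω)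
  omega

/-- **⇒ direction of the reduction in Theorem 4.1.**
Let `ρ` and `Ω ≥ 2` be positive integers, `t = 3ρ`, and `α : Fin (3ρ) → ℕ` positive
integers with `Ω/4 < α i < Ω/2` and `∑ i, α i = ρ·Ω`.  Let `G` be the disjoint union of
cliques of sizes `α i` (the cliques being the fibers of `c : V → Fin (3ρ)`).  If there
is a partition of the vertex set into `ρ` blocks, each of size `Ω`, whose overlap ratio
attains `(∑ i, α_i (α_i − 1)) / (ρ·Ω·(Ω − 1))`, then the index set can be partitioned
into `ρ` triples whose `α`-sums each equal `Ω`. -/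
theorem triple_partition_of_optimal_layout
    [Fintype V] [DecidableEq V]
    (ρ Ω : ℕ) (hρ : 0 < ρ) (hΩ : 2 ≤ Ω)
    (α : Fin (3 * ρ) → ℕ) (hpos : ∀ i, 0 < α i)
    (hlb : ∀ i, Ω < 4 * α i) (hub : ∀ i, 2 * α i < Ω)
    (hsum : ∑ i, α i = ρ * Ω)
    (G : SimpleGraph V) [DecidableRel G.Adj] (c : V → Fin (3 * ρ))
    (hG : ∀ u v : V, G.Adj u v ↔ u ≠ v ∧ c u = c v)
    (hα : ∀ i, (Finset.univ.filter fun v => c v = i).card = α i)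
    (hlayout : ∃ blk : V → Finset V,
      (∀ v, v ∈ blk v) ∧ (∀ u v : V, v ∈ blk u → blk v = blk u) ∧
      (Finset.univ.image blk).card = ρ ∧ (∀ u, (blk u).card = Ω) ∧
      ORG G blk =
        (∑ i, (α i : ℝ) * ((α i : ℝ) - 1)) / ((ρ : ℝ) * (Ω : ℝ) * ((Ω : ℝ) - 1))) :
    ∃ P : Finset (Finset (Fin (3 * ρ))),
      (∀ p ∈ P, ∀ q ∈ P, p ≠ q → Disjoint p q) ∧
      P.biUnion id = Finset.univ ∧ P.card = ρ ∧
      ∀ p ∈ P, p.card = 3 ∧ ∑ i ∈ p, α i = Ω := by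
  obtain ⟨blk, hmem, hblk, hnum, hcard, hOR⟩ := hlayout
  have hV : Fintype.card V = ρ * Ω := by
    rw [← hsum, ← Finset.card_univ, card_eq_sum_card_fiberwise (f := c) (t := univ) (by simp)]
    exact sum_congr rfl fun i _ => hα i
  have hclique : ∀ u v, c v = c u → v ∈ blk u := by
    have hsub := neighborFinset_subset_of_sum_ORv_eq G blk hΩ hcard (by
      have hpos' : (ρ : ℝ) * Ω ≠ 0 := by
        have : 0 < ρ * Ω := by positivity
        exact_mod_cast this.ne'
      rw [sum_degree_of_fiber_cliques G c α hG hα]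
      rw [ORG, hV, Nat.cast_mul, mul_comm ((ρ : ℝ) * Ω), div_mul_eq_div_div _ ((Ω : ℝ) - 1),
        div_left_inj' hpos'] at hOR
      exact hOR)
    intro u v huv
    by_cases h : u = v
    · exact h ▸ hmem u
    · exact hsub u ((G.mem_neighborFinset u v).2 ((hG u v).2 ⟨h, huv.symm⟩))
  have hmeet : ∀ u w i, i ∈ (blk u).image c → i ∈ (blk w).image c → blk u = blk w := by
    intro u w i hu hw
    obtain ⟨a, ha, rfl⟩ := mem_image.1 hu
    obtain ⟨b, hb, hab⟩ := mem_image.1 hw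
    rw [← hblk u a ha, ← hblk w b hb, hblk a b (hclique a b hab)]
  have hsumBlk : ∀ u, ∑ i ∈ (blk u).image c, α i = Ω := by
    intro u
    rw [← hcard u, card_eq_sum_card_image c (blk u)]
    refine sum_congr rfl fun i hi => ?_
    obtain ⟨a, ha, rfl⟩ := mem_image.1 hi
    rw [← hα]
    congr 1
    ext v
    simp only [mem_filter, mem_univ, true_and]
    exact ⟨fun h => ⟨hblk u a ha ▸ hclique a v h, h⟩, fun h => h.2⟩
  refine ⟨(univ.image blk).image (image c), ?_, ?_, ?_, ?_⟩
  · simp only [mem_image, mem_univ, true_and, exists_exists_eq_and]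
    rintro _ ⟨u, rfl⟩ _ ⟨w, rfl⟩ hne
    refine disjoint_left.2 fun i hu hw => hne ?_
    rw [hmeet u w i hu hw]
  · refine eq_univ_of_forall fun i => ?_
    obtain ⟨v, hv⟩ := card_pos.1 ((hα i).symm ▸ hpos i)
    exact mem_biUnion.2 ⟨_, mem_image_of_mem _ (mem_image_of_mem blk (mem_univ v)),
      mem_image.2 ⟨v, hmem v, (mem_filter.1 hv).2⟩⟩
  · rw [card_image_of_injOn, hnum]
    intro p hp q hq hpq
    obtain ⟨u, -, rfl⟩ := mem_image.1 (mem_coe.1 hp)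
    obtain ⟨w, -, rfl⟩ := mem_image.1 (mem_coe.1 hq)
    have hu := mem_image_of_mem c (hmem u)
    exact hmeet u w (c u) hu (hpq ▸ hu)
  · simp only [mem_image, mem_univ, true_and, exists_exists_eq_and]
    rintro _ ⟨u, rfl⟩
    exact ⟨card_eq_three_of_sum_eq (Nonempty.image ⟨u, hmem u⟩ c) hlb hub (hsumBlk u),
      hsumBlk u⟩
end

section
/- Let ρ and Ω ≥ 2 be positive integers, t = 3ρ, and let α_1, …, α_t be positive integers with Ω/4 < α_i < Ω/2 for every i and Σ_i α_i = ρ·Ω. Let G be the disjoint union of cliques C_1, …, C_t of sizes α_1, …, α_t. If the index set {1, …, t} can be partitioned into ρ triples such that the α-sum of each triple equals Ω, then there exists a partition of the vertex set of G into ρ blocks each of size Ω with OR(G) = (Σ_i α_i(α_i − 1)) / (ρ·Ω·(Ω − 1)). -/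
open Finset

variable {V : Type*}

/-- The vertices whose colour lies in `p` are counted by the sizes of the colour classes. -/
theorem card_filter_mem_eq_sum {ι : Type*} [Fintype V] [DecidableEq ι]
    (c : V → ι) (p : Finset ι) :
    (univ.filter fun v => c v ∈ p).card = ∑ i ∈ p, (univ.filter fun v => c v = i).card := by
  rw [card_eq_sum_card_fiberwise (f := c) (t := p) (fun v hv => by simpa using hv)]
  refine sum_congr rfl fun i hi => ?_
  congr 1
  ext v
  simp only [mem_filter, mem_univ, true_and, and_iff_right_iff_imp]
  rintro rfl
  exact hi

/-- If a block contains the whole clique of `u`, its overlap with the neighbours of `u` is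
that clique without `u`. -/
theorem card_inter_neighborFinset_add_one {ι : Type*} [Fintype V] [DecidableEq V]
    [DecidableEq ι] (G : SimpleGraph V) [DecidableRel G.Adj] (c : V → ι)
    (hG : ∀ u v : V, G.Adj u v ↔ u ≠ v ∧ c u = c v) (u : V) (B : Finset V)
    (hB : ∀ v, c v = c u → v ∈ B) :
    (B ∩ G.neighborFinset u).card + 1 = (univ.filter fun v => c v = c u).card := by
  have h : B ∩ G.neighborFinset u = (univ.filter fun v => c v = c u).erase u := by
    ext v
    simp only [mem_inter, SimpleGraph.mem_neighborFinset, hG, mem_erase, mem_filter, mem_univ,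
      true_and]
    constructor
    · rintro ⟨-, h₁, h₂⟩
      exact ⟨h₁.symm, h₂.symm⟩
    · rintro ⟨h₁, h₂⟩
      exact ⟨hB v h₂, h₁.symm, h₂.symm⟩
  rw [h, card_erase_add_one (by simp)]

/-- **⇐ direction of the reduction in Theorem 4.1.**
Let `ρ` and `Ω ≥ 2` be positive integers, `t = 3ρ`, and `α : Fin (3ρ) → ℕ` positive
integers with `Ω/4 < α i < Ω/2` and `∑ i, α i = ρ·Ω`.  Let `G` be the disjoint union of
cliques of sizes `α i` (the cliques being the fibers of `c : V → Fin (3ρ)`).  If the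
index set can be partitioned into `ρ` triples whose `α`-sums each equal `Ω`, then there
is a partition of the vertex set into `ρ` blocks, each of size `Ω`, whose overlap ratio
attains `(∑ i, α_i (α_i − 1)) / (ρ·Ω·(Ω − 1))`. -/
theorem optimal_layout_of_triple_partition
    [Fintype V] [DecidableEq V]
    (ρ Ω : ℕ) (hρ : 0 < ρ) (hΩ : 2 ≤ Ω)
    (α : Fin (3 * ρ) → ℕ) (hpos : ∀ i, 0 < α i)
    (hlb : ∀ i, Ω < 4 * α i) (hub : ∀ i, 2 * α i < Ω)
    (hsum : ∑ i, α i = ρ * Ω)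
    (G : SimpleGraph V) [DecidableRel G.Adj] (c : V → Fin (3 * ρ))
    (hG : ∀ u v : V, G.Adj u v ↔ u ≠ v ∧ c u = c v)
    (hα : ∀ i, (Finset.univ.filter fun v => c v = i).card = α i)
    (htriples : ∃ P : Finset (Finset (Fin (3 * ρ))),
      (∀ p ∈ P, ∀ q ∈ P, p ≠ q → Disjoint p q) ∧
      P.biUnion id = Finset.univ ∧ P.card = ρ ∧
      ∀ p ∈ P, p.card = 3 ∧ ∑ i ∈ p, α i = Ω) :
    ∃ blk : V → Finset V,
      (∀ v, v ∈ blk v) ∧ (∀ u v : V, v ∈ blk u → blk v = blk u) ∧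
      (Finset.univ.image blk).card = ρ ∧ (∀ u, (blk u).card = Ω) ∧
      ORG G blk =
        (∑ i, (α i : ℝ) * ((α i : ℝ) - 1)) / ((ρ : ℝ) * (Ω : ℝ) * ((Ω : ℝ) - 1)) := by
  obtain ⟨P, hdisj, hcover, hcard, htriple⟩ := htriples
  have hex : ∀ i, ∃ p ∈ P, i ∈ p := fun i => by
    have hi : i ∈ P.biUnion id := hcover ▸ mem_univ i
    simpa using hi
  choose T hTP hT using hex
  have hT_eq : ∀ p ∈ P, ∀ i ∈ p, T i = p := fun p hp i hi => by
    by_contra hne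
    exact disjoint_left.mp (hdisj _ (hTP i) p hp hne) (hT i) hi
  have hsurj : ∀ i, ∃ v, c v = i := fun i => by
    have hi : 0 < (univ.filter fun v => c v = i).card := (hα i).symm ▸ hpos i
    obtain ⟨v, hv⟩ := card_pos.mp hi
    exact ⟨v, (mem_filter.mp hv).2⟩
  let S : Finset (Fin (3 * ρ)) → Finset V := fun p => univ.filter fun v => c v ∈ p
  have hS : ∀ p v, v ∈ S p ↔ c v ∈ p := fun p v => by simp [S]
  have hScard : ∀ p ∈ P, (S p).card = Ω := fun p hp => by
    rw [← (htriple p hp).2, ← sum_congr rfl fun i _ => hα i]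
    exact card_filter_mem_eq_sum c p
  have hSinj : Function.Injective S := fun p q hpq => by
    ext i
    obtain ⟨v, rfl⟩ := hsurj i
    rw [← hS, ← hS, hpq]
  have hV : Fintype.card V = ρ * Ω := by
    rw [← hsum, ← sum_congr rfl fun i _ => hα i, ← card_filter_mem_eq_sum c univ]
    simp
  have hblk : ∀ u, (S (T (c u))).card = Ω := fun u => hScard _ (hTP _)
  refine ⟨fun v => S (T (c v)), fun v => (hS _ _).2 (hT _), fun u v huv => ?_, ?_, hblk, ?_⟩
  · exact congrArg S (hT_eq _ (hTP _) _ ((hS _ _).1 huv))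
  · have himage : univ.image (fun v => S (T (c v))) = P.image S := by
      ext B
      simp only [mem_image, mem_univ, true_and]
      constructor
      · rintro ⟨v, rfl⟩
        exact ⟨_, hTP _, rfl⟩
      · rintro ⟨p, hp, rfl⟩
        obtain ⟨i, hi⟩ : p.Nonempty := card_pos.mp (by rw [(htriple p hp).1]; norm_num)
        obtain ⟨v, rfl⟩ := hsurj i
        exact ⟨v, by rw [hT_eq p hp _ hi]⟩
    rw [himage, card_image_of_injective _ hSinj, hcard]
  · have hOR : ∀ u, ORv G (fun v => S (T (c v))) u = ((α (c u) : ℝ) - 1) / ((Ω : ℝ) - 1) := by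
      intro u
      have h := card_inter_neighborFinset_add_one G c hG u (S (T (c u)))
        fun v hv => (hS _ _).2 (hv ▸ hT _)
      rw [hα] at h
      have h_lt : 1 < (S (T (c u))).card := by rw [hblk]; exact hΩ
      rw [ORv, if_pos h_lt, hblk, ← h]
      push_cast
      rw [add_sub_cancel_right]
    have hfiber : ∑ u, ((α (c u) : ℝ) - 1) = ∑ i, (α i : ℝ) * ((α i : ℝ) - 1) := by
      rw [← sum_fiberwise univ c]
      refine sum_congr rfl fun i _ => ?_
      rw [sum_congr rfl (g := fun _ => (α i : ℝ) - 1)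
        (fun v hv => by rw [(mem_filter.mp hv).2]), sum_const, hα, nsmul_eq_mul]
    rw [ORG, sum_congr rfl fun u _ => hOR u, ← sum_div, hfiber, hV, div_div]
    push_cast
    rw [mul_comm ((Ω : ℝ) - 1)]
end
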